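/- Let r > 0 and let p ∈ ℝ³ satisfy ‖p‖₁ ≤ r. Then there exists a center c among the six points (r/3, 0, 0), (−r/3, 0, 0), (0, r/3, 0), (0, −r/3, 0), (0, 0, r/3), (0, 0, −r/3) such that ‖p − c‖₁ ≤ 2r/3. Equivalently, the l₁-ball of radius r centered at the origin in ℝ³ is covered by the six l₁-balls of radius 2r/3 centered at these six points. -/

import Mathlib

/-- Moving the coordinate of largest absolute value by `r / 3` towards the origin brings a point
of the `l₁`-ball of radius `r` into the `l₁`-ball of radius `2 * r / 3`. -/
theorem abs_sub_or_abs_add_third_le {r a b c : ℝ} (h : |a| + |b| + |c| ≤ r)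
    (hb : |b| ≤ |a|) (hc : |c| ≤ |a|) :
    |a - r / 3| + |b| + |c| ≤ 2 * r / 3 ∨ |a + r / 3| + |b| + |c| ≤ 2 * r / 3 := by
  rcases le_total 0 a with ha | ha
  · left
    rw [abs_of_nonneg ha] at h hb hc
    rcases abs_cases (a - r / 3) with ⟨e, _⟩ | ⟨e, _⟩ <;> rw [e] <;> linarith
  · right
    rw [abs_of_nonpos ha] at h hb hc
    rcases abs_cases (a + r / 3) with ⟨e, _⟩ | ⟨e, _⟩ <;> rw [e] <;> linarith

/-- every point of the `l₁`-ball of radius `r` in `ℝ³` lies within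
`l₁`-distance `2r/3` of one of the six points `(±r/3, 0, 0)`, `(0, ±r/3, 0)`,
`(0, 0, ±r/3)`; i.e. the six `l₁`-balls of radius `2r/3` centered at these points
cover the `l₁`-ball of radius `r`. -/
theorem l1Ball_covered_by_six_smaller (r : ℝ) (hr : 0 < r) (p : Fin 3 → ℝ)
    (hp : ∑ i, |p i| ≤ r) :
    ∃ c : Fin 3 → ℝ,
      (c = ![r/3, 0, 0] ∨ c = ![-(r/3), 0, 0] ∨ c = ![0, r/3, 0] ∨
        c = ![0, -(r/3), 0] ∨ c = ![0, 0, r/3] ∨ c = ![0, 0, -(r/3)]) ∧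
      ∑ i, |p i - c i| ≤ 2 * r / 3 := by
  simp only [Fin.sum_univ_three] at hp ⊢
  have key : (|p 1| ≤ |p 0| ∧ |p 2| ≤ |p 0|) ∨ (|p 0| ≤ |p 1| ∧ |p 2| ≤ |p 1|) ∨
      (|p 0| ≤ |p 2| ∧ |p 1| ≤ |p 2|) := by
    grind
  rcases key with ⟨h₁, h₂⟩ | ⟨h₁, h₂⟩ | ⟨h₁, h₂⟩
  · rcases abs_sub_or_abs_add_third_le hp h₁ h₂ with h | h
    · exact ⟨![r/3, 0, 0], by simp, by simpa using h⟩
    · exact ⟨![-(r/3), 0, 0], by simp, by simpa using h⟩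
  · rcases abs_sub_or_abs_add_third_le (r := r) (by linarith) h₁ h₂ with h | h
    · exact ⟨![0, r/3, 0], by simp, by simp; linarith⟩
    · exact ⟨![0, -(r/3), 0], by simp, by simp; linarith⟩
  · rcases abs_sub_or_abs_add_third_le (r := r) (by linarith) h₁ h₂ with h | h
    · exact ⟨![0, 0, r/3], by simp, by simp; linarith⟩
    · exact ⟨![0, 0, -(r/3)], by simp, by simp; linarith⟩
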